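/- Let A ⊆ B ⊆ ℕ^m be positive affine semigroups with C(A) = C(B), and let K be a field. Then there exist, for each coset g ∈ G(B)/G(A), an ideal I_g of K[A] generated by finitely many monomials t^a (a ∈ A), such that K[B] is isomorphic as a K[A]-module to the direct sum ⊕_{g ∈ G(B)/G(A)} I_g. -/

import Mathlib

open Pointwise

noncomputable section

/-- Coordinatewise cast `ℕ^m → ℚ^m`. -/
def natCastQ {m : ℕ} (x : Fin m → ℕ) : Fin m → ℚ := fun i => (x i : ℚ)

/-- Coordinatewise cast `ℕ^m → ℤ^m`. -/
def natCastZ {m : ℕ} (x : Fin m → ℕ) : Fin m → ℤ := fun i => (x i : ℤ)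

/-- Coordinatewise cast `ℤ^m → ℚ^m`. -/
def intCastQ {m : ℕ} (x : Fin m → ℤ) : Fin m → ℚ := fun i => (x i : ℚ)

/-- The rational convex cone spanned by a subset of `ℕ^m` inside `ℚ^m`. -/
def ratCone {m : ℕ} (X : Set (Fin m → ℕ)) : Set (Fin m → ℚ) :=
  {y | ∃ (k : ℕ) (q : Fin k → ℚ) (x : Fin k → (Fin m → ℕ)),
    (∀ i, 0 ≤ q i) ∧ (∀ i, x i ∈ X) ∧ y = ∑ i, q i • natCastQ (x i)}

/-- `B_A = {x ∈ B : x ∉ B + (A ∖ {0})}`. -/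
def BA {m : ℕ} (A B : AddSubmonoid (Fin m → ℕ)) : Set (Fin m → ℕ) :=
  {x | x ∈ B ∧ x ∉ (B : Set (Fin m → ℕ)) + ((A : Set (Fin m → ℕ)) \ {0})}

/-- The subgroup of `ℤ^m` generated by a subset of `ℕ^m`. -/
def grpZ {m : ℕ} (X : Set (Fin m → ℕ)) : AddSubgroup (Fin m → ℤ) :=
  AddSubgroup.closure (natCastZ '' X)

namespace AddMonoidAlgebra

open DirectSum

variable {K M N Q : Type*} [CommSemiring K] [AddCommMonoid M] [AddCommMonoid N]
  [Module (AddMonoidAlgebra K M) (AddMonoidAlgebra K N)]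

open Classical in
/-- If `N` is a finitely generated `M`-set along `ι`, if the classes `cls` are stable under `M`,
and if each class embeds `M`-equivariantly into `M` through `sh`, then the monoid algebra of `N`
is a direct sum, over the classes, of finitely generated monomial ideals of that of `M`. -/
theorem exists_directSum_monomial_ideals (ι : M → N)
    (hsmul : ∀ a b (r s : K),
      (single a r : AddMonoidAlgebra K M) • (single b s : AddMonoidAlgebra K N) =
        single (ι a + b) (r * s))
    (cls : N → Q) (hcls : ∀ a b, cls (ι a + b) = cls b)
    (sh : N → M) (hsh : ∀ a b, sh (ι a + b) = a + sh b)
    (hinj : ∀ b b', cls b = cls b' → sh b = sh b' → b = b')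
    (C : Finset N) (hC : ∀ b, ∃ c ∈ C, ∃ a, b = ι a + c) :
    ∃ I : Q → Ideal (AddMonoidAlgebra K M),
      (∀ g, ∃ S : Finset M, I g = Ideal.span ((fun a : M => single a (1 : K)) '' S)) ∧
      Nonempty ((⨁ g, I g) ≃ₗ[AddMonoidAlgebra K M] AddMonoidAlgebra K N) := by
  let S : Q → Finset M := fun g => (C.filter (fun c => cls c = g)).image sh
  let I : Q → Ideal (AddMonoidAlgebra K M) :=
    fun g => Ideal.span ((fun a : M => single a (1 : K)) '' S g)
  have hmem : ∀ b (r : K), single (sh b) r ∈ I (cls b) := by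
    intro b r
    obtain ⟨c, hc, a, rfl⟩ := hC b
    have h1 : single (sh c) (1 : K) ∈ I (cls (ι a + c)) := by
      refine Ideal.subset_span ⟨sh c, ?_, rfl⟩
      simp only [S, Finset.coe_image, Finset.coe_filter]
      exact ⟨c, ⟨hc, (hcls a c).symm⟩, rfl⟩
    have h2 := (I (cls (ι a + c))).mul_mem_left (single a r) h1
    rwa [single_mul_single, mul_one, ← hsh] at h2
  have hof : ∀ (g g' : Q) (x : I g) (y : I g'), g = g' → (x : AddMonoidAlgebra K M) = y →
      lof (AddMonoidAlgebra K M) Q (fun g => I g) g x =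
        lof (AddMonoidAlgebra K M) Q (fun g => I g) g' y := by
    rintro g _ x y rfl h
    rw [Subtype.ext h]
  let F₀ : AddMonoidAlgebra K N →+ ⨁ g, I g :=
    (Finsupp.liftAddHom fun b =>
      { toFun := fun r =>
          lof (AddMonoidAlgebra K M) Q (fun g => I g) (cls b) ⟨single (sh b) r, hmem b r⟩
        map_zero' := by
          rw [← map_zero (lof (AddMonoidAlgebra K M) Q (fun g => I g) (cls b))]
          exact hof _ _ _ _ rfl (single_zero _)
        map_add' := fun r s => by
          rw [← map_add]
          exact hof _ _ _ _ rfl (single_add _ _ _) }).comp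
      coeffAddEquiv.toAddMonoidHom
  have hF₀ : ∀ b (r : K), F₀ (single b r) =
      lof (AddMonoidAlgebra K M) Q (fun g => I g) (cls b) ⟨single (sh b) r, hmem b r⟩ := by
    intro b r
    exact Finsupp.liftAddHom_apply_single _ _ _
  let F : AddMonoidAlgebra K N →ₗ[AddMonoidAlgebra K M] ⨁ g, I g :=
    { F₀ with
      map_smul' := by
        intro x y
        change F₀ (x • y) = x • F₀ y
        induction x using induction_linear with
        | zero => simp
        | add x x' hx hx' => simp only [add_smul, map_add, hx, hx']
        | single a r =>
          induction y using induction_linear with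
          | zero => simp
          | add y y' hy hy' => simp only [smul_add, map_add, hy, hy']
          | single b s =>
            rw [hsmul, hF₀, hF₀, ← map_smul]
            refine hof _ _ _ _ (hcls a b) ?_
            simp [hsh, single_mul_single] }
  have hF : ∀ b (r : K), F (single b r) =
      lof (AddMonoidAlgebra K M) Q (fun g => I g) (cls b) ⟨single (sh b) r, hmem b r⟩ := hF₀
  let un : Q → M → N := fun g a => if h : ∃ b, cls b = g ∧ sh b = a then h.choose else 0
  have hun : ∀ b, un (cls b) (sh b) = b := by
    intro b
    have h : ∃ b', cls b' = cls b ∧ sh b' = sh b := ⟨b, rfl, rfl⟩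
    simp only [un, dif_pos h]
    exact hinj _ _ h.choose_spec.1 h.choose_spec.2
  let G : (⨁ g, I g) →+ AddMonoidAlgebra K N :=
    DirectSum.toAddMonoid fun g =>
      { toFun := fun x => mapDomain (un g) (x : AddMonoidAlgebra K M)
        map_zero' := mapDomain_zero _
        map_add' := fun x y => mapDomain_add _ _ _ }
  have hGF : ∀ y, G (F y) = y := by
    intro y
    induction y using induction_linear with
    | zero => simp
    | add y y' hy hy' => simp only [map_add, hy, hy']
    | single b s =>
      rw [hF]
      refine (DirectSum.toAddMonoid_of _ _ _).trans ?_
      change mapDomain _ (single _ _) = _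
      rw [mapDomain_single, hun]
  have hsurj : ∀ g (x : I g), lof (AddMonoidAlgebra K M) Q (fun g => I g) g x ∈
      LinearMap.range F := by
    rintro g ⟨x, hx⟩
    induction hx using Submodule.span_induction with
    | mem x h =>
      obtain ⟨a, ha, rfl⟩ := h
      simp only [S, Finset.coe_image, Finset.coe_filter] at ha
      obtain ⟨c, ⟨-, rfl⟩, rfl⟩ := ha
      exact ⟨single c 1, hF c 1⟩
    | zero => exact (map_zero (lof (AddMonoidAlgebra K M) Q (fun g => I g) g)) ▸ zero_mem _
    | add x y hx hy hx' hy' =>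
      have := add_mem hx' hy'
      rw [← map_add] at this
      exact this
    | smul a x hx hx' =>
      have := Submodule.smul_mem _ a hx'
      rw [← map_smul] at this
      exact this
  refine ⟨I, fun g => ⟨S g, rfl⟩, ⟨(LinearEquiv.ofBijective F
    ⟨Function.LeftInverse.injective hGF, fun z => ?_⟩).symm⟩⟩
  change z ∈ LinearMap.range F
  induction z using DirectSum.induction_on with
  | zero => exact zero_mem _
  | of g x => exact hsurj g x
  | add x y hx hy => exact add_mem hx hy

end AddMonoidAlgebra

/-- Finitely many nonnegative rationals have a common denominator. -/
theorem exists_common_denominator {k : ℕ} (q : Fin k → ℚ) (hq : ∀ i, 0 ≤ q i) :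
    ∃ n : ℕ, 0 < n ∧ ∃ p : Fin k → ℕ, ∀ i, (n : ℚ) * q i = p i := by
  refine ⟨∏ i, (q i).den, Finset.prod_pos fun i _ => (q i).den_pos,
    fun i => (∏ j ∈ Finset.univ.erase i, (q j).den) * (q i).num.toNat, fun i => ?_⟩
  have h : (((q i).num.toNat : ℕ) : ℚ) = (q i).num := by
    exact_mod_cast Int.toNat_of_nonneg (Rat.num_nonneg.2 (hq i))
  rw [← Finset.prod_erase_mul _ _ (Finset.mem_univ i)]
  push_cast
  rw [h, mul_assoc, Rat.den_mul_eq_num]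

theorem exists_nsmul_mem_of_natCastQ_mem_ratCone {m : ℕ} (A : AddSubmonoid (Fin m → ℕ))
    {x : Fin m → ℕ} (hx : natCastQ x ∈ ratCone (A : Set (Fin m → ℕ))) :
    ∃ n : ℕ, 0 < n ∧ n • x ∈ A := by
  obtain ⟨k, q, y, hq, hy, h⟩ := hx
  obtain ⟨n, hn, p, hp⟩ := exists_common_denominator q hq
  refine ⟨n, hn, ?_⟩
  have : n • x = ∑ i, p i • y i := by
    ext j
    have hj := congrFun h j
    simp only [natCastQ, Finset.sum_apply, Pi.smul_apply, smul_eq_mul] at hj ⊢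
    have : (n : ℚ) * (x j : ℚ) = ∑ i, (p i : ℚ) * (y i j : ℚ) := by
      rw [hj, Finset.mul_sum]
      exact Finset.sum_congr rfl fun i _ => by rw [← hp i, mul_assoc]
    exact_mod_cast this
  rw [this]
  exact sum_mem fun i _ => A.nsmul_mem (hy i) _

theorem subset_ratCone {m : ℕ} {X : Set (Fin m → ℕ)} {x : Fin m → ℕ} (hx : x ∈ X) :
    natCastQ x ∈ ratCone X :=
  ⟨1, fun _ => 1, fun _ => x, by simp, by simpa using hx, by simp⟩

open Classical in
/-- A finitely generated commutative monoid, each of whose elements has a positive multiple in a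
submonoid `A`, is covered by finitely many translates of `A`. -/
theorem exists_finset_translates_cover {M : Type*} [AddCommMonoid M] (A B : AddSubmonoid M)
    (hB : B.FG) (h : ∀ b ∈ B, ∃ n : ℕ, 0 < n ∧ n • b ∈ A) :
    ∃ C : Finset M, (∀ c ∈ C, c ∈ B) ∧ ∀ b ∈ B, ∃ c ∈ C, ∃ a ∈ A, b = a + c := by
  obtain ⟨S, rfl⟩ := hB
  induction S using Finset.induction_on with
  | empty =>
    refine ⟨{0}, by simp, fun b hb => ⟨0, by simp, 0, A.zero_mem, ?_⟩⟩
    simpa using hb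
  | insert s S _ ih =>
    have hle : AddSubmonoid.closure (S : Set M) ≤
        AddSubmonoid.closure ((insert s S : Finset M) : Set M) :=
      AddSubmonoid.closure_mono (by simp)
    have hs : s ∈ AddSubmonoid.closure ((insert s S : Finset M) : Set M) :=
      AddSubmonoid.subset_closure (by simp)
    obtain ⟨C, hC, hcov⟩ := ih fun b hb => h b (hle hb)
    obtain ⟨n, hn, hns⟩ := h s hs
    refine ⟨(Finset.range n ×ˢ C).image fun p => p.1 • s + p.2, ?_, fun b hb => ?_⟩
    · intro c hc
      obtain ⟨⟨r, c⟩, hrc, rfl⟩ := Finset.mem_image.1 hc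
      exact add_mem (nsmul_mem hs r) (hle (hC c (Finset.mem_product.1 hrc).2))
    · rw [Finset.coe_insert, Set.insert_eq, AddSubmonoid.closure_union,
        AddSubmonoid.mem_sup] at hb
      obtain ⟨y, hy, z, hz, rfl⟩ := hb
      obtain ⟨k, rfl⟩ := AddSubmonoid.mem_closure_singleton.1 hy
      obtain ⟨c, hc, a, ha, rfl⟩ := hcov z hz
      refine ⟨(k % n) • s + c, Finset.mem_image.2 ⟨(k % n, c), ?_, rfl⟩,
        (k / n) • (n • s) + a, add_mem (nsmul_mem hns _) ha, ?_⟩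
      · exact Finset.mem_product.2 ⟨Finset.mem_range.2 (Nat.mod_lt _ hn), hc⟩
      · have : k • s = (k / n) • (n • s) + (k % n) • s := by
          rw [← mul_nsmul, ← add_nsmul, Nat.div_add_mod]
        rw [this]
        abel

theorem natCastZ_add {m : ℕ} (x y : Fin m → ℕ) : natCastZ (x + y) = natCastZ x + natCastZ y := by
  ext; simp [natCastZ]

theorem natCastZ_injective {m : ℕ} : Function.Injective (natCastZ (m := m)) := by
  intro x y h
  ext j
  exact Int.ofNat.inj (congrFun h j)

theorem exists_sub_of_mem_grpZ {m : ℕ} (A : AddSubmonoid (Fin m → ℕ)) {z : Fin m → ℤ}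
    (hz : z ∈ grpZ (A : Set (Fin m → ℕ))) :
    ∃ a ∈ A, ∃ a' ∈ A, z = natCastZ a - natCastZ a' := by
  have h0 : natCastZ (0 : Fin m → ℕ) = 0 := by ext; simp [natCastZ]
  induction hz using AddSubgroup.closure_induction with
  | mem x hx =>
    obtain ⟨a, ha, rfl⟩ := hx
    exact ⟨a, ha, 0, A.zero_mem, by rw [h0, sub_zero]⟩
  | zero => exact ⟨0, A.zero_mem, 0, A.zero_mem, by simp⟩
  | add x y _ _ hx hy =>
    obtain ⟨a, ha, a', ha', rfl⟩ := hx
    obtain ⟨b, hb, b', hb', rfl⟩ := hy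
    exact ⟨a + b, add_mem ha hb, a' + b', add_mem ha' hb', by
      rw [natCastZ_add, natCastZ_add]; abel⟩
  | neg x _ hx =>
    obtain ⟨a, ha, a', ha', rfl⟩ := hx
    exact ⟨a', ha', a, ha, by abel⟩

/-- Finitely many elements congruent to `v` modulo `G(A)` are moved into `v + A` by one common
translation. -/
theorem exists_common_translation {m : ℕ} (A : AddSubmonoid (Fin m → ℕ)) (v : Fin m → ℕ)
    (C : Finset (Fin m → ℕ))
    (hC : ∀ c ∈ C, natCastZ c - natCastZ v ∈ grpZ (A : Set (Fin m → ℕ))) :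
    ∃ u ∈ A, ∀ c ∈ C, ∃ a ∈ A, a + v = c + u := by
  classical
  induction C using Finset.induction_on with
  | empty => exact ⟨0, A.zero_mem, by simp⟩
  | insert c C _ ih =>
    obtain ⟨u, hu, h⟩ := ih fun c hc => hC c (Finset.mem_insert_of_mem hc)
    obtain ⟨a, ha, a', ha', e⟩ := exists_sub_of_mem_grpZ A (hC c (Finset.mem_insert_self _ _))
    have e' : a + v = c + a' := by
      apply natCastZ_injective
      rw [natCastZ_add, natCastZ_add]
      linear_combination -e
    refine ⟨u + a', add_mem hu ha', fun d hd => ?_⟩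
    rcases Finset.mem_insert.1 hd with rfl | hd
    · exact ⟨a + u, add_mem ha hu, by rw [add_right_comm, e']; abel⟩
    · obtain ⟨b, hb, eb⟩ := h d hd
      exact ⟨b + a', add_mem hb ha', by rw [add_right_comm, eb]; abel⟩

open DirectSum in
/-- There exist monomial ideals `I_g ⊆ K[A]`, one for each coset
`g ∈ G(B)/G(A)`, each generated by finitely many monomials `t^a` with `a ∈ A`, such that
`K[B]` is isomorphic as a `K[A]`-module to `⊕_g I_g`. -/
theorem decomposition_into_monomial_ideals {m : ℕ} (K : Type*) [Field K]
    (A B : AddSubmonoid (Fin m → ℕ)) (hAB : A ≤ B) (hA : A.FG) (hB : B.FG)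
    (hC : ratCone (A : Set (Fin m → ℕ)) = ratCone (B : Set (Fin m → ℕ))) :
    ∃ I : (grpZ (B : Set (Fin m → ℕ)) ⧸
        (grpZ (A : Set (Fin m → ℕ))).addSubgroupOf (grpZ (B : Set (Fin m → ℕ)))) →
        Ideal (AddMonoidAlgebra K A),
      (∀ g, ∃ S : Finset A,
        I g = Ideal.span ((fun a : A => AddMonoidAlgebra.single a (1 : K)) '' S)) ∧
      (letI := (AddMonoidAlgebra.mapDomainRingHom K (AddSubmonoid.inclusion hAB)).toModule
       Nonempty ((⨁ g, I g) ≃ₗ[AddMonoidAlgebra K A] AddMonoidAlgebra K B)) := by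
  have hgrp : ∀ b : B, natCastZ b ∈ grpZ (B : Set (Fin m → ℕ)) := fun b =>
    AddSubgroup.subset_closure ⟨b, b.2, rfl⟩
  let cls : B → (grpZ (B : Set (Fin m → ℕ)) ⧸
      (grpZ (A : Set (Fin m → ℕ))).addSubgroupOf (grpZ (B : Set (Fin m → ℕ)))) :=
    fun b => QuotientAddGroup.mk ⟨natCastZ b, hgrp b⟩
  have hcls_iff : ∀ b b' : B, cls b = cls b' ↔
      natCastZ (b' : Fin m → ℕ) - natCastZ b ∈ grpZ (A : Set (Fin m → ℕ)) := by
    intro b b'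
    refine QuotientAddGroup.eq.trans ?_
    rw [AddSubgroup.mem_addSubgroupOf]
    simp [neg_add_eq_sub]
  have hcls : ∀ (a : A) (b : B), cls (AddSubmonoid.inclusion hAB a + b) = cls b := by
    intro a b
    refine ((hcls_iff _ _).2 ?_).symm
    have : natCastZ ((AddSubmonoid.inclusion hAB a + b : B) : Fin m → ℕ) - natCastZ b =
        natCastZ a := by
      simp [natCastZ_add]
    rw [this]
    exact AddSubgroup.subset_closure ⟨a, a.2, rfl⟩
  obtain ⟨C, hCB, hcov⟩ := exists_finset_translates_cover A B hB fun b hb =>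
    exists_nsmul_mem_of_natCastQ_mem_ratCone A (hC ▸ subset_ratCone hb)
  classical
  let D : Finset B := C.subtype (· ∈ B)
  have hD : ∀ b : B, ∃ c ∈ D, ∃ a : A, b = AddSubmonoid.inclusion hAB a + c := by
    intro b
    obtain ⟨c, hc, a, ha, h⟩ := hcov b b.2
    exact ⟨⟨c, hCB c hc⟩, Finset.mem_subtype.2 hc, ⟨a, ha⟩, Subtype.ext h⟩
  have htrans : ∀ g, ∃ u v : Fin m → ℕ, ∀ b : B, cls b = g →
      ∃ a : A, (a : Fin m → ℕ) + v = b + u := by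
    intro g
    by_cases hg : ∃ c₀, cls c₀ = g
    · obtain ⟨c₀, rfl⟩ := hg
      obtain ⟨u, -, hu⟩ := exists_common_translation A c₀
        ((D.filter fun c => cls c = cls c₀).image Subtype.val) (by
          intro x hx
          obtain ⟨c, hc, rfl⟩ := Finset.mem_image.1 hx
          exact (hcls_iff _ _).1 (Finset.mem_filter.1 hc).2.symm)
      refine ⟨u, c₀, fun b hb => ?_⟩
      obtain ⟨c, hc, a, rfl⟩ := hD b
      rw [hcls] at hb
      obtain ⟨a', ha', h⟩ := hu c (Finset.mem_image_of_mem _ (Finset.mem_filter.2 ⟨hc, hb⟩))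
      refine ⟨a + ⟨a', ha'⟩, ?_⟩
      simp [add_assoc, h]
    · exact ⟨0, 0, fun b hb => (hg ⟨b, hb⟩).elim⟩
  choose u v huv using htrans
  choose sh hsh using fun b : B => huv (cls b) b rfl
  let := (AddMonoidAlgebra.mapDomainRingHom K (AddSubmonoid.inclusion hAB)).toModule
  refine AddMonoidAlgebra.exists_directSum_monomial_ideals (AddSubmonoid.inclusion hAB) ?_ cls
    hcls sh ?_ ?_ D hD
  · intro a b r s
    change AddMonoidAlgebra.mapDomainRingHom K (AddSubmonoid.inclusion hAB) _ * _ = _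
    simp [AddMonoidAlgebra.single_mul_single]
  · intro a b
    apply Subtype.ext
    have h1 := hsh (AddSubmonoid.inclusion hAB a + b)
    rw [hcls] at h1
    apply add_right_cancel (b := v (cls b))
    rw [h1, AddSubmonoid.coe_add, AddSubmonoid.coe_add, add_assoc, add_assoc, hsh b]
    rfl
  · intro b b' hb hs
    apply Subtype.ext
    have h1 := hsh b
    rw [hb, hs, hsh b'] at h1
    exact (add_right_cancel h1).symm
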